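/- Let f be a monotone nonnegative submodular function on subsets of V with multilinear extension F(y) = Σ_{S ⊆ V} f(S) Π_{i∈S} y_i Π_{i∉S} (1−y_i). Suppose x is a probability distribution over subsets of V and define ŷ_i = Σ_{S : i∈S} x_S. Then F(ŷ) ≥ (1 − 1/e) · Σ_S x_S f(S). -/

import Mathlib

/-- The multilinear extension of a set function `f`. -/
noncomputable def mle {V : Type*} [Fintype V] [DecidableEq V]
    (f : Finset V → ℝ) (y : V → ℝ) : ℝ :=
  ∑ S : Finset V, f S * ((∏ i ∈ S, y i) * ∏ i ∈ Sᶜ, (1 - y i))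

/-- The product weight of a set. -/
noncomputable def wgt {V : Type*} [Fintype V] [DecidableEq V] (y : V → ℝ) (S : Finset V) : ℝ :=
  ∏ j, if j ∈ S then y j else 1 - y j

theorem wgt_eq {V : Type*} [Fintype V] [DecidableEq V] (y : V → ℝ) (S : Finset V) :
    wgt y S = (∏ i ∈ S, y i) * ∏ i ∈ Sᶜ, (1 - y i) := by
  unfold wgt
  rw [← Finset.prod_mul_prod_compl S]
  congr 1
  · exact Finset.prod_congr rfl fun i hi => by simp [hi]
  · exact Finset.prod_congr rfl fun i hi => by simp [Finset.mem_compl.1 hi]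

theorem mle_eq {V : Type*} [Fintype V] [DecidableEq V] (f : Finset V → ℝ) (y : V → ℝ) :
    mle f y = ∑ S : Finset V, f S * wgt y S := by
  unfold mle
  exact Finset.sum_congr rfl fun S _ => by rw [wgt_eq]

theorem wgt_sum {V : Type*} [Fintype V] [DecidableEq V] (y : V → ℝ) :
    ∑ S : Finset V, wgt y S = 1 := by
  have h := Finset.prod_add y (fun i => 1 - y i) Finset.univ
  simp only [add_sub_cancel, Finset.prod_const_one, Finset.powerset_univ] at h
  rw [h]
  exact Finset.sum_congr rfl fun S _ => by rw [wgt_eq, Finset.compl_eq_univ_sdiff]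

theorem wgt_nonneg {V : Type*} [Fintype V] [DecidableEq V] (y : V → ℝ)
    (h0 : ∀ i, 0 ≤ y i) (h1 : ∀ i, y i ≤ 1) (S : Finset V) : 0 ≤ wgt y S := by
  refine Finset.prod_nonneg fun i _ => ?_
  split_ifs
  · exact h0 i
  · linarith [h1 i]

theorem submod_bound {V : Type*} [DecidableEq V] (f : Finset V → ℝ)
    (hmono : ∀ X Y : Finset V, X ⊆ Y → f X ≤ f Y)
    (hsub : ∀ X Y : Finset V, X ⊆ Y → ∀ e ∉ Y,
      f (insert e Y) - f Y ≤ f (insert e X) - f X) (S T : Finset V) :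
    f (S ∪ T) - f S ≤ ∑ i ∈ T, (f (insert i S) - f S) := by
  induction T using Finset.induction_on with
  | empty => simp
  | insert a T ha ih =>
    rw [Finset.sum_insert ha, Finset.union_insert]
    by_cases h : a ∈ S ∪ T
    · rw [Finset.insert_eq_of_mem h]
      have := hmono S (insert a S) (Finset.subset_insert _ _)
      linarith
    · have := hsub S (S ∪ T) Finset.subset_union_left a h
      linarith

theorem sum_split {V : Type*} [Fintype V] [DecidableEq V] (i : V) (g : Finset V → ℝ) :
    ∑ S : Finset V, g S = ∑ S ∈ (Finset.univ.erase i).powerset, (g S + g (insert i S)) := by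
  rw [Finset.sum_add_distrib, ← Finset.sum_powerset_insert (Finset.notMem_erase i _),
    Finset.insert_erase (Finset.mem_univ i), Finset.powerset_univ]

theorem coord_bound {V : Type*} [Fintype V] [DecidableEq V] (f : Finset V → ℝ)
    (hmono : ∀ X Y : Finset V, X ⊆ Y → f X ≤ f Y) (y : V → ℝ)
    (h0 : ∀ i, 0 ≤ y i) (h1 : ∀ i, y i ≤ 1) (i : V) :
    ∑ S : Finset V, (f (insert i S) - f S) * wgt y S ≤
      ∑ S : Finset V, f S * ((∏ j ∈ Finset.univ.erase i, if j ∈ S then y j else 1 - y j) *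
        (if i ∈ S then 1 else -1)) := by
  rw [sum_split i, sum_split i]
  refine Finset.sum_le_sum fun S hS => ?_
  have hi : i ∉ S := fun h => by simpa using Finset.mem_powerset.1 hS h
  have hA : (∏ j ∈ Finset.univ.erase i, if j ∈ insert i S then y j else 1 - y j)
      = ∏ j ∈ Finset.univ.erase i, if j ∈ S then y j else 1 - y j :=
    Finset.prod_congr rfl fun j hj => by simp [Finset.ne_of_mem_erase hj]
  have hw : wgt y S = (1 - y i) *
      ∏ j ∈ Finset.univ.erase i, if j ∈ S then y j else 1 - y j := by
    unfold wgt
    rw [← Finset.mul_prod_erase _ _ (Finset.mem_univ i)]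
    simp [hi]
  have hAn : 0 ≤ ∏ j ∈ Finset.univ.erase i, if j ∈ S then y j else 1 - y j := by
    refine Finset.prod_nonneg fun j _ => ?_
    split_ifs
    · exact h0 j
    · linarith [h1 j]
  rw [hA, hw]
  simp only [hi, Finset.insert_idem, Finset.mem_insert_self, if_true, if_false, sub_self, zero_mul]
  have hm := hmono S (insert i S) (Finset.subset_insert _ _)
  nlinarith [mul_nonneg (mul_nonneg (sub_nonneg.2 hm) hAn) (h0 i)]

theorem stmt_3 {V : Type*} [Fintype V] [DecidableEq V] (f : Finset V → ℝ)
    (hnn : ∀ S, 0 ≤ f S)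
    (hmono : ∀ X Y : Finset V, X ⊆ Y → f X ≤ f Y)
    (hsub : ∀ X Y : Finset V, X ⊆ Y → ∀ e ∉ Y,
      f (insert e Y) - f Y ≤ f (insert e X) - f X)
    (x : Finset V → ℝ) (hx0 : ∀ S, 0 ≤ x S) (hsum : ∑ S : Finset V, x S = 1)
    (yhat : V → ℝ)
    (hyhat : ∀ i, yhat i = ∑ S : Finset V, if i ∈ S then x S else 0) :
    mle f yhat ≥ (1 - 1 / Real.exp 1) * ∑ S : Finset V, x S * f S := by
  set C := ∑ S : Finset V, x S * f S with hC
  have hy0 : ∀ i, 0 ≤ yhat i := fun i => by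
    rw [hyhat]
    exact Finset.sum_nonneg fun S _ => by split_ifs <;> simp [hx0]
  have hy1 : ∀ i, yhat i ≤ 1 := fun i => by
    rw [hyhat, ← hsum]
    exact Finset.sum_le_sum fun S _ => by split_ifs <;> simp [hx0]
  -- the pointwise bound
  have hpt : ∀ S : Finset V, C - f S ≤ ∑ i, yhat i * (f (insert i S) - f S) := by
    intro S
    have e1 : ∑ i, yhat i * (f (insert i S) - f S)
        = ∑ T : Finset V, x T * ∑ i ∈ T, (f (insert i S) - f S) := by
      simp_rw [hyhat, Finset.sum_mul]
      rw [Finset.sum_comm]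
      refine Finset.sum_congr rfl fun T _ => ?_
      rw [Finset.mul_sum]
      simp [ite_mul, Finset.sum_ite_mem]
    have e2 : C - f S = ∑ T : Finset V, x T * (f T - f S) := by
      simp_rw [mul_sub, Finset.sum_sub_distrib, ← Finset.sum_mul, hsum, one_mul, hC]
    rw [e1, e2]
    refine Finset.sum_le_sum fun T _ => mul_le_mul_of_nonneg_left ?_ (hx0 T)
    have := submod_bound f hmono hsub S T
    have := hmono T (S ∪ T) Finset.subset_union_right
    linarith
  let P : ℝ → ℝ := fun t => ∑ S : Finset V, f S * wgt (fun i => t * yhat i) S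
  let D : ℝ → ℝ := fun t => ∑ S : Finset V, f S * ∑ i,
    (∏ j ∈ Finset.univ.erase i, if j ∈ S then t * yhat j else 1 - t * yhat j) *
      (if i ∈ S then yhat i else - yhat i)
  have hP : ∀ t, HasDerivAt P (D t) t := by
    intro t
    refine HasDerivAt.fun_sum fun S _ => HasDerivAt.const_mul _ ?_
    unfold wgt
    have := HasDerivAt.fun_finsetProd (u := (Finset.univ : Finset V)) (x := t)
      (f := fun j t => if j ∈ S then t * yhat j else 1 - t * yhat j)
      (f' := fun i => if i ∈ S then yhat i else - yhat i) (fun i _ => by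
        by_cases h : i ∈ S
        · simpa [h] using (hasDerivAt_id t).mul_const (yhat i)
        · simpa [h] using ((hasDerivAt_id t).mul_const (yhat i)).const_sub 1)
    simpa only [smul_eq_mul] using this
  have hD : ∀ t, 0 ≤ t → t ≤ 1 → C - P t ≤ D t := by
    intro t ht0 ht1
    have g0 : ∀ i, 0 ≤ t * yhat i := fun i => mul_nonneg ht0 (hy0 i)
    have g1 : ∀ i, t * yhat i ≤ 1 := fun i => mul_le_one₀ ht1 (hy0 i) (hy1 i)
    have e1 : D t = ∑ i, yhat i * ∑ S : Finset V, f S *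
        ((∏ j ∈ Finset.univ.erase i, if j ∈ S then t * yhat j else 1 - t * yhat j) *
        (if i ∈ S then 1 else -1)) := by
      simp only [D, Finset.mul_sum]
      rw [Finset.sum_comm]
      refine Finset.sum_congr rfl fun i _ => Finset.sum_congr rfl fun S _ => ?_
      split_ifs <;> ring
    have e2 : C - P t = ∑ S : Finset V, (C - f S) * wgt (fun i => t * yhat i) S := by
      simp_rw [sub_mul, Finset.sum_sub_distrib, ← Finset.mul_sum, wgt_sum, mul_one, P]
    calc C - P t ≤ ∑ S : Finset V, (∑ i, yhat i * (f (insert i S) - f S)) *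
          wgt (fun i => t * yhat i) S := by
          rw [e2]
          exact Finset.sum_le_sum fun S _ =>
            mul_le_mul_of_nonneg_right (hpt S) (wgt_nonneg _ g0 g1 S)
      _ = ∑ i, yhat i * ∑ S : Finset V, (f (insert i S) - f S) *
          wgt (fun i => t * yhat i) S := by
          simp only [Finset.sum_mul, Finset.mul_sum]
          rw [Finset.sum_comm]
          simp only [mul_assoc]
      _ ≤ D t := by
          rw [e1]
          exact Finset.sum_le_sum fun i _ => mul_le_mul_of_nonneg_left
            (coord_bound f hmono (fun i => t * yhat i) g0 g1 i) (hy0 i)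
  have hQ : ∀ t, HasDerivAt (fun t => Real.exp t * (P t - C))
      (Real.exp t * (P t - C) + Real.exp t * D t) t := fun t =>
    (Real.hasDerivAt_exp t).mul ((hP t).sub_const C)
  have hm : MonotoneOn (fun t => Real.exp t * (P t - C)) (Set.Icc 0 1) := by
    refine monotoneOn_of_deriv_nonneg (convex_Icc 0 1)
      (fun t _ => (hQ t).continuousAt.continuousWithinAt)
      (fun t _ => (hQ t).differentiableAt.differentiableWithinAt) fun t ht => ?_
    rw [interior_Icc] at ht
    rw [(hQ t).deriv, ← mul_add]
    exact mul_nonneg (Real.exp_pos t).le (by linarith [hD t ht.1.le ht.2.le])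
  have h01 := hm (Set.left_mem_Icc.2 zero_le_one) (Set.right_mem_Icc.2 zero_le_one) zero_le_one
  have hP0 : 0 ≤ P 0 := Finset.sum_nonneg fun S _ =>
    mul_nonneg (hnn S) (wgt_nonneg _ (by simp) (by simp) S)
  have hP1 : P 1 = mle f yhat := by simp [P, mle_eq]
  simp only [Real.exp_zero, one_mul, hP1] at h01
  have he := Real.exp_pos 1
  have h2 : -C / Real.exp 1 ≤ mle f yhat - C := by
    rw [div_le_iff₀ he]
    linarith
  have h3 : (1 - 1 / Real.exp 1) * C = C + -C / Real.exp 1 := by ring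
  rw [h3]
  linarith
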